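/- arXiv:math/0401223 — 2 statements merged into one kernel-verified Lean document; each statement's English description precedes it below -/
import Mathlib

section
/- Let $Q_k(u,v)$ be the probability that the order statistics $\xi_1 \le \cdots \le \xi_k$ of $k$ independent uniform random variables on $[0,1]$ satisfy $\xi_i \ge (i-u)/v$ for all $i$. There is an absolute constant $C$ such that for all $k \ge 1$, $u > 0$, and $v$ with $w := u + v - k > 0$, one has $Q_k(u,v) \le C \frac{(u+1)(w+1)^2}{k}$. -/
open MeasureTheory

/-- Increasing `n`-tuples in `[0, t]` whose `i`-th entry is at least `a i`. -/
def orderedRegion (a : ℕ → ℝ) (n : ℕ) (t : ℝ) : Set (Fin n → ℝ) :=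
  {ξ | (∀ i j : Fin n, i ≤ j → ξ i ≤ ξ j) ∧ (∀ i : Fin n, 0 ≤ ξ i ∧ ξ i ≤ t) ∧
    (∀ i : Fin n, a i ≤ ξ i)}

theorem isClosed_orderedRegion (a : ℕ → ℝ) (n : ℕ) (t : ℝ) :
    IsClosed (orderedRegion a n t) := by
  unfold orderedRegion
  simp only [Set.ofPred_and, Set.ofPred_forall]
  refine IsClosed.inter ?_ (IsClosed.inter ?_ ?_)
  · exact isClosed_iInter fun i => isClosed_iInter fun j => isClosed_iInter fun _ =>
      isClosed_le (continuous_apply i) (continuous_apply j)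
  · exact isClosed_iInter fun i => (isClosed_le continuous_const (continuous_apply i)).inter
      (isClosed_le (continuous_apply i) continuous_const)
  · exact isClosed_iInter fun i => isClosed_le continuous_const (continuous_apply i)

theorem measurable_volume_orderedRegion (a : ℕ → ℝ) (n : ℕ) :
    Measurable fun t => volume (orderedRegion a n t) := by
  refine Monotone.measurable fun s t hst => measure_mono ?_
  rintro ξ ⟨h1, h2, h3⟩
  exact ⟨h1, fun i => ⟨(h2 i).1, (h2 i).2.trans hst⟩, h3⟩

theorem mem_orderedRegion_succ (a : ℕ → ℝ) (n : ℕ) (t : ℝ) (ξ : Fin (n + 1) → ℝ) :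
    ξ ∈ orderedRegion a (n + 1) t ↔
      ξ (Fin.last n) ∈ Set.Icc 0 t ∩ Set.Ici (a n) ∧
        (fun i : Fin n => ξ i.castSucc) ∈ orderedRegion a n (ξ (Fin.last n)) := by
  constructor
  · rintro ⟨h1, h2, h3⟩
    refine ⟨⟨h2 _, by simpa using h3 (Fin.last n)⟩, fun i j hij => h1 _ _ (by simpa using hij),
      fun i => ⟨(h2 _).1, h1 _ _ (Fin.le_last _)⟩, fun i => by simpa using h3 i.castSucc⟩
  · rintro ⟨⟨h0, ha⟩, h1, h2, h3⟩
    refine ⟨fun i j hij => ?_, fun i => ?_, fun i => ?_⟩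
    · induction j using Fin.lastCases with
      | last =>
        induction i using Fin.lastCases with
        | last => exact le_rfl
        | cast i => exact (h2 i).2
      | cast j =>
        induction i using Fin.lastCases with
        | last => exact absurd hij (not_le.2 (Fin.castSucc_lt_last j))
        | cast i => exact h1 i j (by simpa using hij)
    · induction i using Fin.lastCases with
      | last => exact h0
      | cast i => exact ⟨(h2 i).1, (h2 i).2.trans h0.2⟩
    · induction i using Fin.lastCases with
      | last => simpa using ha
      | cast i => simpa using h3 i

theorem volume_orderedRegion_succ (a : ℕ → ℝ) (n : ℕ) (t : ℝ) :
    volume (orderedRegion a (n + 1) t) =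
      ∫⁻ s in Set.Icc 0 t ∩ Set.Ici (a n), volume (orderedRegion a n s) := by
  have hmp := (volume_preserving_piFinSuccAbove (fun _ : Fin (n + 1) => ℝ) (Fin.last n)).symm
  have hm : MeasurableSet (orderedRegion a (n + 1) t) :=
    (isClosed_orderedRegion a (n + 1) t).measurableSet
  rw [← hmp.measure_preimage hm.nullMeasurableSet, Measure.volume_eq_prod,
    Measure.prod_apply (hmp.measurable hm),
    ← lintegral_indicator (measurableSet_Icc.inter measurableSet_Ici)]
  refine lintegral_congr fun x => ?_
  have key : ∀ y : Fin n → ℝ,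
      (MeasurableEquiv.piFinSuccAbove (fun _ : Fin (n + 1) => ℝ) (Fin.last n)).symm (x, y) ∈
        orderedRegion a (n + 1) t ↔
      x ∈ Set.Icc 0 t ∩ Set.Ici (a n) ∧ y ∈ orderedRegion a n x := by
    intro y
    rw [mem_orderedRegion_succ]
    simp [MeasurableEquiv.piFinSuccAbove, Fin.insertNthEquiv]
  by_cases hx : x ∈ Set.Icc 0 t ∩ Set.Ici (a n)
  · rw [Set.indicator_of_mem hx]
    congr 1
    ext y
    exact (key y).trans (and_iff_right hx)
  · rw [Set.indicator_of_notMem hx]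
    convert measure_empty
    · ext y
      simpa using fun h => hx ((key y).1 h).1
    · infer_instance

theorem volume_orderedRegion_eq_zero {a : ℕ → ℝ} {n : ℕ} {t : ℝ} (h : t ≤ a n) :
    volume (orderedRegion a (n + 1) t) = 0 := by
  rw [volume_orderedRegion_succ]
  refine setLIntegral_measure_zero _ _ (measure_mono_null (t := {t}) ?_ (by simp))
  rintro x ⟨⟨_, hx⟩, hx'⟩
  exact le_antisymm hx (h.trans hx')

/-- The kernel `(t - s)₊ ^ n / n!` of the `(n + 1)`-fold iterated integral. -/
noncomputable def iteratedKernel (n : ℕ) (t s : ℝ) : ENNReal :=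
  if s ≤ t then ENNReal.ofReal ((t - s) ^ n / n.factorial) else 0

theorem measurable_iteratedKernel (n : ℕ) :
    Measurable fun p : ℝ × ℝ => iteratedKernel n p.1 p.2 := by
  unfold iteratedKernel
  refine Measurable.ite (measurableSet_le measurable_snd measurable_fst) ?_ measurable_const
  fun_prop

theorem lintegral_iteratedKernel (n : ℕ) (t : ℝ) {s : ℝ} (hs : 0 ≤ s) :
    ∫⁻ τ in Set.Icc 0 t, iteratedKernel n τ s = iteratedKernel (n + 1) t s := by
  have h1 : ∫⁻ τ in Set.Icc 0 t, iteratedKernel n τ s =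
      ∫⁻ τ in Set.Icc s t, ENNReal.ofReal ((τ - s) ^ n / n.factorial) := by
    rw [← lintegral_indicator measurableSet_Icc, ← lintegral_indicator measurableSet_Icc]
    refine lintegral_congr fun τ => ?_
    simp only [Set.indicator_apply, Set.mem_Icc, iteratedKernel]
    split_ifs <;> first | rfl | grind
  rw [h1, iteratedKernel]
  split_ifs with hst
  · rw [← ofReal_integral_eq_lintegral_ofReal]
    · rw [integral_Icc_eq_integral_Ioc, ← intervalIntegral.integral_of_le hst,
        intervalIntegral.integral_div,
        intervalIntegral.integral_comp_sub_right (fun x : ℝ => x ^ n) s, integral_pow,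
        Nat.factorial_succ]
      congr 1
      push_cast
      have : (n.factorial : ℝ) ≠ 0 := by positivity
      field_simp
      simp
    · exact Continuous.integrableOn_Icc (by fun_prop)
    · refine (ae_restrict_iff' measurableSet_Icc).2 (Filter.Eventually.of_forall fun τ hτ => ?_)
      have := sub_nonneg.2 hτ.1
      simp only [Pi.zero_apply]
      positivity
  · rw [Set.Icc_eq_empty hst]
    simp

/-- Classification of all increasing tuples by the first index `l` violating the barrier. -/
theorem iteratedKernel_eq_volume_add_sum (a : ℕ → ℝ) (n : ℕ) {t : ℝ} (ht : 0 ≤ t) :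
    iteratedKernel n t 0 = volume (orderedRegion a n t) +
      ∑ l ∈ Finset.range n, ∫⁻ s in Set.Ico 0 (a l),
        volume (orderedRegion a l s) * iteratedKernel (n - 1 - l) t s := by
  induction n generalizing t with
  | zero =>
    have : orderedRegion a 0 t = Set.univ := by
      ext ξ
      simp [orderedRegion]
    simp [iteratedKernel, ht, this, volume_pi]
  | succ n ih =>
    have hG := measurable_volume_orderedRegion a
    have hprod : ∀ l m : ℕ, Measurable fun p : ℝ × ℝ =>
        volume (orderedRegion a l p.2) * iteratedKernel m p.1 p.2 := fun l m =>
      ((hG l).comp measurable_snd).mul (measurable_iteratedKernel m)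
    have hsplit : ∫⁻ τ in Set.Icc 0 t, volume (orderedRegion a n τ) =
        volume (orderedRegion a (n + 1) t) +
          ∫⁻ s in Set.Ico 0 (a n), volume (orderedRegion a n s) * iteratedKernel 0 t s := by
      rw [volume_orderedRegion_succ,
        ← lintegral_inter_add_sdiff _ (Set.Icc 0 t) (measurableSet_Ici (a := a n))]
      congr 1
      rw [← lintegral_indicator (measurableSet_Icc.diff measurableSet_Ici),
        ← lintegral_indicator measurableSet_Ico]
      refine lintegral_congr fun τ => ?_
      simp only [Set.indicator_apply, Set.mem_sdiff, Set.mem_Icc, Set.mem_Ici, Set.mem_Ico,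
        iteratedKernel, pow_zero, Nat.factorial_zero]
      split_ifs <;> first | grind | simp
    have hstep : ∀ l ∈ Finset.range n, ∫⁻ τ in Set.Icc 0 t, ∫⁻ s in Set.Ico 0 (a l),
          volume (orderedRegion a l s) * iteratedKernel (n - 1 - l) τ s =
        ∫⁻ s in Set.Ico 0 (a l),
          volume (orderedRegion a l s) * iteratedKernel (n + 1 - 1 - l) t s := by
      intro l hl
      rw [lintegral_lintegral_swap (hprod l _).aemeasurable]
      refine setLIntegral_congr_fun measurableSet_Ico fun s hs => ?_
      have hidx : n + 1 - 1 - l = n - 1 - l + 1 := by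
        have := Finset.mem_range.1 hl
        omega
      have hmeas : Measurable fun τ => iteratedKernel (n - 1 - l) τ s :=
        (measurable_iteratedKernel _).comp (measurable_id.prodMk measurable_const)
      rw [lintegral_const_mul _ hmeas,
        lintegral_iteratedKernel _ _ hs.1, hidx]
    rw [← lintegral_iteratedKernel n t le_rfl,
      setLIntegral_congr_fun measurableSet_Icc fun τ hτ => ih hτ.1,
      lintegral_add_left (hG n), lintegral_finsetSum _ fun l _ => (hprod l _).lintegral_prod_right',
      Finset.sum_congr rfl hstep, hsplit, Finset.sum_range_succ, add_assoc,
      show n + 1 - 1 - n = 0 by omega]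
    ac_rfl

theorem exp_mul_one_sub_le_one_add_div_pow {r : ℕ} {x w : ℝ} (hx : 0 < x) (hrx : (r : ℝ) ≤ x)
    (hxr : x ≤ r + 1) (hw : 0 < w) :
    Real.exp w * (1 - w * (1 + w) / (r + 1)) ≤ (1 + w / x) ^ r := by
  have hr : (0 : ℝ) ≤ r := r.cast_nonneg
  have hpos : 0 < 1 + w / x := by positivity
  have hlog := Real.one_sub_inv_le_log_of_pos hpos
  have heq : 1 - (1 + w / x)⁻¹ = w / (x + w) := by
    field_simp
    ring
  rw [heq] at hlog
  have hexp : w - w * (1 + w) / (r + 1) ≤ r * (w / (x + w)) := by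
    rw [sub_le_iff_le_add, ← mul_div_assoc, div_add_div _ _ (by positivity) (by positivity),
      le_div_iff₀ (by positivity)]
    nlinarith [mul_nonneg hw.le (sub_nonneg.2 hxr), mul_nonneg hw.le (sub_nonneg.2 hrx),
      mul_nonneg (mul_nonneg hw.le hr) (sub_nonneg.2 hxr),
      mul_nonneg (mul_nonneg hw.le hw.le) (sub_nonneg.2 hrx), mul_pos hw hw,
      mul_pos (mul_pos hw hw) hw]
  calc Real.exp w * (1 - w * (1 + w) / (r + 1))
      ≤ Real.exp w * Real.exp (-(w * (1 + w) / (r + 1))) := by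
        gcongr
        linarith [Real.add_one_le_exp (-(w * (1 + w) / (r + 1)))]
    _ = Real.exp (w - w * (1 + w) / (r + 1)) := by rw [← Real.exp_add]; ring_nf
    _ ≤ Real.exp (r * Real.log (1 + w / x)) := by
        gcongr
        exact hexp.trans (by gcongr)
    _ = (1 + w / x) ^ r := by rw [Real.exp_nat_mul, Real.exp_log hpos]

theorem one_sub_le_exp_neg_sub_sq_half {y : ℝ} (h0 : 0 ≤ y) (h1 : y ≤ 1) :
    1 - y ≤ Real.exp (-y - y ^ 2 / 2) := by
  rcases h1.eq_or_lt with rfl | h1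
  · simpa using (Real.exp_pos _).le
  have hs := Real.hasSum_pow_div_log_of_abs_lt_one (abs_lt.2 ⟨by linarith, h1⟩)
  have := hs.summable.sum_le_tsum (Finset.range 2) fun i _ => by positivity
  rw [hs.tsum_eq] at this
  norm_num [Finset.sum_range_succ] at this
  rw [← Real.log_le_iff_le_exp (by linarith)]
  linarith

theorem one_sub_four_div_pow_le {r : ℕ} {x : ℝ} (hx : 4 ≤ x) (hxr : x ≤ r + 1) :
    Real.exp 4 * (1 - 4 / x) ^ r ≤ 1 - 1 / (r + 1) := by
  have hr : (3 : ℝ) ≤ r := by linarith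
  have hx0 : 0 < x := by linarith
  have hy1 : 4 / x ≤ 1 := by rwa [div_le_one hx0]
  have hy : 4 / ((r : ℝ) + 1) ≤ 4 / x := by gcongr
  have hy0 : 0 < 4 / ((r : ℝ) + 1) := by positivity
  have hexp : 4 + r * (-(4 / x) - (4 / x) ^ 2 / 2) ≤ -(2 / (r + 1)) := by
    have h : 4 + r * (-(4 / x) - (4 / x) ^ 2 / 2) ≤
        4 + r * (-(4 / ((r : ℝ) + 1)) - (4 / ((r : ℝ) + 1)) ^ 2 / 2) := by gcongr
    refine h.trans ?_
    have : -(2 / ((r : ℝ) + 1)) -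
        (4 + r * (-(4 / ((r : ℝ) + 1)) - (4 / ((r : ℝ) + 1)) ^ 2 / 2)) =
        (2 * r - 6) / (r + 1) ^ 2 := by
      field_simp
      ring
    have h2 : (0 : ℝ) ≤ (2 * r - 6) / (r + 1) ^ 2 :=
      div_nonneg (by linarith) (by positivity)
    linarith
  calc Real.exp 4 * (1 - 4 / x) ^ r
      ≤ Real.exp 4 * Real.exp (-(4 / x) - (4 / x) ^ 2 / 2) ^ r := by
        have := sub_nonneg.2 hy1
        gcongr
        exact one_sub_le_exp_neg_sub_sq_half (by positivity) hy1
    _ = Real.exp (4 + r * (-(4 / x) - (4 / x) ^ 2 / 2)) := by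
        rw [← Real.exp_nat_mul, ← Real.exp_add]
    _ ≤ Real.exp (-(2 / (r + 1))) := by gcongr
    _ ≤ 1 - 1 / (r + 1) := by
        rw [Real.exp_neg, inv_le_comm₀ (Real.exp_pos _)]
        · refine le_trans ?_ (Real.add_one_le_exp _)
          rw [inv_le_iff_one_le_mul₀]
          · have : (2 / ((r : ℝ) + 1) + 1) * (1 - 1 / (r + 1)) - 1 = (r - 1) / (r + 1) ^ 2 := by
              field_simp
              ring
            have h2 : (0 : ℝ) ≤ (r - 1) / (r + 1) ^ 2 :=
              div_nonneg (by linarith) (by positivity)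
            linarith
          · rw [sub_pos, div_lt_one] <;> linarith
        · rw [sub_pos, div_lt_one] <;> linarith

theorem pow_add_comparison {r : ℕ} {x w : ℝ} (hx : 0 < x) (hrx : (r : ℝ) ≤ x)
    (hxr : x ≤ r + 1) (hw : 0 < w) :
    Real.exp w * x ^ r +
        w * (1 + w) * Real.exp w * (if 4 ≤ x then Real.exp 4 * (x - 4) ^ r else 0) ≤
      (x + w) ^ r + w * (1 + w) * Real.exp w * x ^ r := by
  have hA := exp_mul_one_sub_le_one_add_div_pow hx hrx hxr hw
  have hB : (if 4 ≤ x then Real.exp 4 * (x - 4) ^ r else 0) ≤ (1 - 1 / (r + 1)) * x ^ r := by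
    split_ifs with h4
    · have : (x - 4) ^ r = (1 - 4 / x) ^ r * x ^ r := by
        rw [← mul_pow]
        congr 1
        field_simp
      rw [this, ← mul_assoc]
      gcongr
      exact one_sub_four_div_pow_le h4 hxr
    · have : (1 : ℝ) / (r + 1) ≤ 1 := by
        rw [div_le_one (by positivity)]
        linarith [r.cast_nonneg (α := ℝ)]
      have := sub_nonneg.2 this
      positivity
  have hA' : Real.exp w * (1 - w * (1 + w) / (r + 1)) * x ^ r ≤ (x + w) ^ r := by
    have : (x + w) ^ r = (1 + w / x) ^ r * x ^ r := by
      rw [← mul_pow]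
      congr 1
      field_simp
    rw [this]
    gcongr
  have hB' := mul_le_mul_of_nonneg_left hB (by positivity : 0 ≤ w * (1 + w) * Real.exp w)
  have : w * (1 + w) * Real.exp w * ((1 - 1 / ((r : ℝ) + 1)) * x ^ r) =
      w * (1 + w) * Real.exp w * x ^ r - Real.exp w * x ^ r +
        Real.exp w * (1 - w * (1 + w) / (r + 1)) * x ^ r := by
    field_simp
    ring
  linarith

theorem iteratedKernel_comparison {r : ℕ} {v w x s t : ℝ} (hv : 0 < v) (hw : 0 < w)
    (hx : 0 < x) (hrx : (r : ℝ) ≤ x) (hxr : x ≤ r + 1) (hs : x = v * t - v * s) :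
    ENNReal.ofReal (Real.exp w) * iteratedKernel r t s +
        ENNReal.ofReal (w * (1 + w) * Real.exp w * Real.exp 4) * iteratedKernel r (t - 4 / v) s ≤
      iteratedKernel r (t + w / v) s +
        ENNReal.ofReal (w * (1 + w) * Real.exp w) * iteratedKernel r t s := by
  have hkernel : ∀ y d : ℝ, x + d = y → iteratedKernel r (t + d / v) s =
      ENNReal.ofReal ((if 0 ≤ y then y ^ r else 0) / (v ^ r * r.factorial)) := by
    rintro _ d rfl
    have h1 : t + d / v - s = (x + d) / v := by
      rw [hs]
      field_simp
      ring
    have h2 : s ≤ t + d / v ↔ 0 ≤ x + d := by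
      rw [← sub_nonneg, h1, le_div_iff₀ hv, zero_mul]
    rw [iteratedKernel, h1]
    simp only [h2]
    split_ifs
    · rw [div_pow, div_div]
    · simp
  have h0 := hkernel x 0 (by ring)
  have h4 := hkernel (x - 4) (-4) (by ring)
  rw [zero_div, add_zero, if_pos hx.le] at h0
  rw [neg_div, ← sub_eq_add_neg] at h4
  simp only [sub_nonneg] at h4
  rw [h0, h4, hkernel (x + w) w rfl, if_pos (by positivity : 0 ≤ x + w)]
  have hc : (0 : ℝ) ≤ (if 4 ≤ x then (x - 4) ^ r else 0) := by
    split_ifs with h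
    · exact pow_nonneg (sub_nonneg.2 h) r
    · exact le_rfl
  rw [← ENNReal.ofReal_mul (by positivity), ← ENNReal.ofReal_mul (by positivity),
    ← ENNReal.ofReal_mul (by positivity), ← ENNReal.ofReal_add (by positivity) (by positivity),
    ← ENNReal.ofReal_add (by positivity) (by positivity)]
  apply ENNReal.ofReal_le_ofReal
  have := pow_add_comparison hx hrx hxr hw
  rw [← mul_div_assoc, ← mul_div_assoc, ← mul_div_assoc, ← add_div, ← add_div]
  refine div_le_div_of_nonneg_right (le_trans (le_of_eq ?_) this) (by positivity)
  split_ifs <;> ring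

theorem iteratedKernel_add_volume_le {k : ℕ} {u v : ℝ} (hk : 1 ≤ k) (hu : 0 < u) (hv : 0 < v)
    (hw : 0 < u + v - k) (huk : 4 ≤ k - u) :
    ENNReal.ofReal (Real.exp (u + v - k)) * iteratedKernel k ((k - u) / v) 0 +
        ENNReal.ofReal ((u + v - k) * (1 + (u + v - k)) * Real.exp (u + v - k) * Real.exp 4) *
          iteratedKernel k ((k - u) / v - 4 / v) 0 +
        volume (orderedRegion (fun i => ((i : ℝ) + 1 - u) / v) k 1) ≤
      iteratedKernel k 1 0 +
        ENNReal.ofReal ((u + v - k) * (1 + (u + v - k)) * Real.exp (u + v - k)) *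
          iteratedKernel k ((k - u) / v) 0 := by
  set a : ℕ → ℝ := fun i => ((i : ℝ) + 1 - u) / v
  set w := u + v - k
  obtain ⟨n, rfl⟩ : ∃ n, k = n + 1 := ⟨k - 1, by omega⟩
  set t := (((n + 1 : ℕ) : ℝ) - u) / v
  have ht : t + w / v = 1 := by
    simp only [t, w]
    field_simp
    ring
  have ht0 : 0 ≤ t - 4 / v := by
    rw [← sub_div]
    exact div_nonneg (by linarith) hv.le
  have h4v : 0 < 4 / v := by positivity
  have han : a n = t := by simp [a, t]
  have hzero : ∀ τ ≤ t, volume (orderedRegion a (n + 1) τ) = 0 := fun τ hτ =>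
    volume_orderedRegion_eq_zero (hτ.trans_eq han.symm)
  have hmeas : ∀ (r l : ℕ) (τ : ℝ), Measurable fun s =>
      volume (orderedRegion a l s) * iteratedKernel r τ s := fun r l τ =>
    (measurable_volume_orderedRegion a l).mul
      ((measurable_iteratedKernel r).comp (measurable_const.prodMk measurable_id))
  rw [iteratedKernel_eq_volume_add_sum a (n + 1) zero_le_one,
    iteratedKernel_eq_volume_add_sum a (n + 1) (by linarith : 0 ≤ t),
    iteratedKernel_eq_volume_add_sum a (n + 1) ht0, hzero t le_rfl, hzero (t - 4 / v) (by linarith),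
    zero_add, zero_add, add_comm _ (volume _), add_assoc]
  refine add_le_add le_rfl ?_
  simp only [Finset.mul_sum, ← Finset.sum_add_distrib]
  refine Finset.sum_le_sum fun l hl => ?_
  rw [← lintegral_const_mul _ (hmeas _ _ _), ← lintegral_const_mul _ (hmeas _ _ _),
    ← lintegral_const_mul _ (hmeas _ _ _), ← lintegral_add_left ((hmeas _ _ _).const_mul _),
    ← lintegral_add_left (hmeas _ _ _)]
  refine setLIntegral_mono ((hmeas _ _ _).add ((hmeas _ _ _).const_mul _)) fun s hs => ?_
  by_cases hvol : volume (orderedRegion a l s) = 0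
  · simp [hvol]
  have hl' : l ≤ n := by
    have := Finset.mem_range.1 hl
    omega
  have hlow : (l : ℝ) - u < v * s := by
    rcases l with _ | m
    · have := mul_nonneg hv.le hs.1
      push_cast
      linarith
    · have : a m < s := not_le.1 fun h => hvol (volume_orderedRegion_eq_zero h)
      rw [div_lt_iff₀ hv] at this
      push_cast
      linarith
  have hupp : v * s < l + 1 - u := by
    have := hs.2
    rw [lt_div_iff₀ hv] at this
    linarith
  have hvt : v * t = n + 1 - u := by
    simp only [t]
    push_cast
    field_simp
  have hr : ((n + 1 - 1 - l : ℕ) : ℝ) = n - l := by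
    rw [Nat.add_sub_cancel, Nat.cast_sub hl']
  have hln : (l : ℝ) ≤ n := by exact_mod_cast hl'
  have := iteratedKernel_comparison (r := n + 1 - 1 - l) (t := t) (s := s) hv hw
    (by linarith : 0 < v * t - v * s) (by linarith) (by linarith) rfl
  rw [ht] at this
  refine le_trans (le_of_eq ?_)
    ((mul_le_mul' (le_refl (volume (orderedRegion a l s))) this).trans (le_of_eq ?_)) <;> ring

theorem factorial_mul_volume_le_one (a : ℕ → ℝ) (k : ℕ) :
    (k.factorial : ℝ) * (volume (orderedRegion a k 1)).toReal ≤ 1 := by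
  have h : volume (orderedRegion a k 1) ≤ ENNReal.ofReal (1 / k.factorial) := by
    have := iteratedKernel_eq_volume_add_sum a k zero_le_one
    simp only [iteratedKernel, zero_le_one, if_true, sub_zero, one_pow] at this
    rw [this]
    exact le_self_add
  have := ENNReal.toReal_le_of_le_ofReal (by positivity) h
  rwa [le_div_iff₀' (by positivity)] at this

theorem factorial_mul_volume_le {k : ℕ} {u v : ℝ} (hk : 1 ≤ k) (hu : 0 < u) (hv : 0 < v)
    (hw : 0 < u + v - k) (huk : 4 ≤ k - u) :
    (k.factorial : ℝ) *
        (volume (orderedRegion (fun i => ((i : ℝ) + 1 - u) / v) k 1)).toReal ≤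
      1 + (u + v - k) * (1 + (u + v - k)) * Real.exp (u + v - k) * ((k - u) / v) ^ k -
        Real.exp (u + v - k) * ((k - u) / v) ^ k -
        (u + v - k) * (1 + (u + v - k)) * Real.exp (u + v - k) * Real.exp 4 *
          ((k - u - 4) / v) ^ k := by
  have h := iteratedKernel_add_volume_le hk hu hv hw huk
  set V := volume (orderedRegion (fun i => ((i : ℝ) + 1 - u) / v) k 1)
  set w := u + v - k
  have ht1 : 0 ≤ (k - u) / v := div_nonneg (by linarith) hv.le
  have ht0 : 0 ≤ (k - u - 4) / v := div_nonneg (by linarith) hv.le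
  have hV : V ≠ ⊤ := by
    refine ne_top_of_le_ne_top ?_ (le_add_self.trans h)
    simp only [iteratedKernel]
    split_ifs <;> finiteness
  have hker : ∀ τ : ℝ, 0 ≤ τ → iteratedKernel k τ 0 = ENNReal.ofReal (τ ^ k / k.factorial) :=
    fun τ hτ => by rw [iteratedKernel, if_pos hτ, sub_zero]
  rw [← sub_div, hker _ ht1, hker _ ht0, hker _ zero_le_one, ← ENNReal.ofReal_toReal hV,
    ← ENNReal.ofReal_mul (by positivity), ← ENNReal.ofReal_mul (by positivity),
    ← ENNReal.ofReal_mul (by positivity), ← ENNReal.ofReal_add (by positivity) (by positivity),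
    ← ENNReal.ofReal_add (by positivity) (by positivity),
    ← ENNReal.ofReal_add (by positivity) (by positivity),
    ENNReal.ofReal_le_ofReal_iff (by positivity)] at h
  have hfac : (0 : ℝ) < k.factorial := by positivity
  have hcancel : ∀ c X : ℝ, (k.factorial : ℝ) * (c * (X / k.factorial)) = c * X := by
    intro c X
    field_simp
  have := mul_le_mul_of_nonneg_left h hfac.le
  rw [mul_add (k.factorial : ℝ), mul_add (k.factorial : ℝ), mul_add (k.factorial : ℝ),
    hcancel, hcancel, hcancel, one_pow,
    mul_one_div_cancel hfac.ne'] at this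
  linarith

theorem exp_neg_le_div_pow {p c : ℝ} (hp : 0 < p) (hc : 0 ≤ c) (k : ℕ) :
    Real.exp (-(k * c / p)) ≤ (p / (p + c)) ^ k := by
  have h : Real.exp (-(c / p)) ≤ p / (p + c) := by
    have : p / (p + c) = (1 + c / p)⁻¹ := by field_simp
    rw [Real.exp_neg, this]
    gcongr
    linarith [Real.add_one_le_exp (c / p)]
  calc Real.exp (-(k * c / p)) = Real.exp (-(c / p)) ^ k := by
        rw [← Real.exp_nat_mul]
        ring_nf
    _ ≤ _ := by gcongr

theorem div_pow_le_exp_neg {p c : ℝ} (hp : 0 < p) (hc : 0 ≤ c) (k : ℕ) :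
    (p / (p + c)) ^ k ≤ Real.exp (-(k * c / (p + c))) := by
  have hpc : p + c ≠ 0 := by positivity
  have h : p / (p + c) ≤ Real.exp (-(c / (p + c))) := by
    have : p / (p + c) = -(c / (p + c)) + 1 := by
      field_simp
      ring
    rw [this]
    exact Real.add_one_le_exp _
  calc (p / (p + c)) ^ k ≤ Real.exp (-(c / (p + c))) ^ k := by gcongr
    _ = _ := by
        rw [← Real.exp_nat_mul]
        ring_nf

theorem comparison_bound {k : ℕ} {u w p : ℝ} (hk : (16 : ℝ) ≤ k) (hu : 0 < u) (huk : u ≤ k / 2)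
    (hw : 0 < w) (hwk : w ^ 2 ≤ k) (hp : p = k - u) :
    1 + w * (1 + w) * Real.exp w * (p / (p + w)) ^ k - Real.exp w * (p / (p + w)) ^ k -
        w * (1 + w) * Real.exp w * Real.exp 4 * ((p - 4) / (p + w)) ^ k ≤
      514 * ((u + 1) * (w + 1) ^ 2) / k := by
  have hk0 : (0 : ℝ) < k := by linarith
  have hp2 : (k : ℝ) / 2 ≤ p := by linarith
  have hp4 : (k : ℝ) / 4 ≤ p - 4 := by linarith
  have hp0 : 0 < p := by linarith
  have hp40 : 0 < p - 4 := by linarith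
  set X := Real.exp w * (p / (p + w)) ^ k with hX
  set Y := Real.exp 4 * ((p - 4) / p) ^ k with hY
  have hXlow : 1 - 2 * w * u / k ≤ X := by
    have h : Real.exp w * Real.exp (-(k * w / p)) ≤ X := by
      rw [hX]
      gcongr
      exact exp_neg_le_div_pow hp0 hw.le k
    rw [← Real.exp_add] at h
    have h1 : w + -(k * w / p) = -(w * u / p) := by
      rw [show (k : ℝ) = p + u by linarith]
      field_simp
      ring
    have h2 : w * u / p ≤ 2 * w * u / k := by
      rw [div_le_div_iff₀ hp0 hk0]
      nlinarith [mul_pos hw hu]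
    linarith [Real.add_one_le_exp (w + -(k * w / p))]
  have hXupp : X ≤ 8 := by
    have h : X ≤ Real.exp w * Real.exp (-(k * w / (p + w))) := by
      rw [hX]
      gcongr
      exact div_pow_le_exp_neg hp0 hw.le k
    rw [← Real.exp_add] at h
    have h1 : w + -(k * w / (p + w)) ≤ 2 := by
      have : w + -(k * w / (p + w)) = w * (w - u) / (p + w) := by
        rw [show (k : ℝ) = p + u by linarith]
        field_simp
        ring
      rw [this, div_le_iff₀ (by linarith)]
      nlinarith [mul_pos hw hu]
    have h2 : Real.exp 2 ≤ 8 := by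
      have := Real.exp_one_lt_d9
      rw [show (2 : ℝ) = 1 + 1 by norm_num, Real.exp_add]
      nlinarith [Real.exp_pos 1]
    exact h.trans ((Real.exp_le_exp.2 h1).trans h2)
  have hYlow : 1 - 16 * (u + 4) / k ≤ Y := by
    have h : Real.exp 4 * Real.exp (-(k * 4 / (p - 4))) ≤ Y := by
      have := exp_neg_le_div_pow hp40 zero_le_four k
      rw [sub_add_cancel] at this
      rw [hY]
      gcongr
    rw [← Real.exp_add] at h
    have h1 : 4 + -(k * 4 / (p - 4)) = -(4 * (u + 4) / (p - 4)) := by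
      rw [show (k : ℝ) = p + u by linarith]
      field_simp
      ring
    have h2 : 4 * (u + 4) / (p - 4) ≤ 16 * (u + 4) / k := by
      rw [div_le_div_iff₀ hp40 hk0]
      nlinarith
    linarith [Real.add_one_le_exp (4 + -(k * 4 / (p - 4)))]
  have hX0 : 0 ≤ X := by positivity
  have hsplit : ((p - 4) / (p + w)) ^ k = ((p - 4) / p) ^ k * (p / (p + w)) ^ k := by
    rw [← mul_pow, div_mul_div_cancel₀ hp0.ne']
  have hprod : X * (1 - Y) ≤ 8 * (16 * (u + 4) / k) :=
    (mul_le_mul_of_nonneg_left (by linarith) hX0).trans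
      (mul_le_mul_of_nonneg_right hXupp (by positivity))
  calc _ = 1 - X + w * (1 + w) * (X * (1 - Y)) := by
        rw [hsplit, hX, hY]
        ring
    _ ≤ 2 * w * u / k + w * (1 + w) * (8 * (16 * (u + 4) / k)) := by
        gcongr
        linarith
    _ = (2 * w * u + 128 * (w * (1 + w) * (u + 4))) / k := by
        field_simp
        ring
    _ ≤ _ := by
        gcongr
        nlinarith [mul_pos hw hu, mul_pos (mul_pos hw hw) hu, mul_pos hw hw]

theorem stmt12 :
    ∃ C : ℝ, 0 < C ∧
      ∀ (k : ℕ) (u v : ℝ), 1 ≤ k → 0 < u → 0 < u + v - (k : ℝ) →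
        (k.factorial : ℝ) *
            (volume {ξ : Fin k → ℝ |
              (∀ i j : Fin k, i ≤ j → ξ i ≤ ξ j) ∧
              (∀ i : Fin k, 0 ≤ ξ i ∧ ξ i ≤ 1) ∧
              (∀ i : Fin k, ((i : ℕ) + 1 - u) / v ≤ ξ i)}).toReal
          ≤ C * ((u + 1) * (u + v - (k : ℝ) + 1) ^ 2) / (k : ℝ) := by
  refine ⟨514, by norm_num, fun k u v hk hu hw => ?_⟩
  change (k.factorial : ℝ) *
    (volume (orderedRegion (fun i => ((i : ℝ) + 1 - u) / v) k 1)).toReal ≤ _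
  have hk1 : (1 : ℝ) ≤ k := by exact_mod_cast hk
  by_cases hlarge : 16 ≤ (k : ℝ) ∧ u ≤ k / 2 ∧ (u + v - k) ^ 2 ≤ k
  · obtain ⟨hk16, huk, hwk⟩ := hlarge
    have hv : 0 < v := by linarith
    refine (factorial_mul_volume_le hk hu hv hw (by linarith)).trans ?_
    have := comparison_bound hk16 hu huk hw hwk rfl
    rwa [show (k : ℝ) - u + (u + v - k) = v by ring] at this
  · refine (factorial_mul_volume_le_one _ k).trans ?_
    rw [le_div_iff₀ (by linarith), one_mul]
    generalize u + v - k = w at *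
    by_contra! hlt
    refine hlarge ⟨?_, ?_, ?_⟩ <;>
      nlinarith [mul_pos hw hu, mul_pos hw hw, mul_pos (mul_pos hw hw) hu]
end

section
/- Fix $\ell \ge 1$. There is a constant $C_\ell$ such that uniformly in $x \ge 1$ and $y \ge 4$: $\sum_{n} \frac{\log(d_{\ell+1}(n)/d_\ell(n))}{n} \le C_\ell (\log y)(\log\log y)^{\nu(\ell)+1} \exp\{-\frac{\log x}{4 \log y}\}$, where the sum is over integers $n \ge x$ with $P^+(n) \le y$ and $\tau(n) \ge \ell+1$. -/
open scoped Classical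

/-- The `j`-th smallest divisor of `n` (1-indexed). -/
def dth (n j : ℕ) : ℕ := ((n.divisors.sort (· ≤ ·)).getD (j - 1) 0)

theorem dth_succ_eq_orderEmbOfFin {n j : ℕ} (hj : j < n.divisors.card) :
    dth n (j + 1) = n.divisors.orderEmbOfFin rfl ⟨j, hj⟩ := by
  have h : j < (n.divisors.sort (· ≤ ·)).length := by simpa using hj
  rw [dth, Nat.add_sub_cancel, List.getD_eq_getElem _ _ h]
  rfl

theorem dth_consecutive {n ℓ : ℕ} (hℓ : 1 ≤ ℓ) (h : ℓ + 1 ≤ n.divisors.card) :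
    dth n ℓ ∈ n.divisors ∧ dth n (ℓ + 1) ∈ n.divisors ∧ dth n ℓ < dth n (ℓ + 1) ∧
      (n.divisors.filter (· ≤ dth n ℓ)).card = ℓ ∧
      ∀ c ∈ n.divisors, dth n ℓ < c → dth n (ℓ + 1) ≤ c := by
  obtain ⟨j, rfl⟩ : ∃ j, ℓ = j + 1 := ⟨ℓ - 1, by omega⟩
  rw [dth_succ_eq_orderEmbOfFin (by omega : j < _), dth_succ_eq_orderEmbOfFin (by omega : j + 1 < _)]
  set e := n.divisors.orderEmbOfFin rfl with he
  have hsurj : ∀ c ∈ n.divisors, ∃ i, e i = c := fun c hc ↦ by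
    have : c ∈ Set.range e := by rw [he, Finset.range_orderEmbOfFin]; exact hc
    exact this
  refine ⟨Finset.orderEmbOfFin_mem _ _ _, Finset.orderEmbOfFin_mem _ _ _, ?_, ?_, ?_⟩
  · exact e.strictMono (by simp [Fin.lt_def])
  · have : n.divisors.filter (· ≤ e ⟨j, by omega⟩) =
        (Finset.Iic (⟨j, by omega⟩ : Fin n.divisors.card)).map e.toEmbedding := by
      ext c
      simp only [Finset.mem_filter, Finset.mem_map, Finset.mem_Iic, RelEmbedding.coe_toEmbedding]
      constructor
      · rintro ⟨hc, hle⟩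
        obtain ⟨i, rfl⟩ := hsurj c hc
        exact ⟨i, e.le_iff_le.1 hle, rfl⟩
      · rintro ⟨i, hi, rfl⟩
        exact ⟨Finset.orderEmbOfFin_mem _ _ _, e.le_iff_le.2 hi⟩
    rw [this, Finset.card_map, Fin.card_Iic]
  · intro c hc hlt
    obtain ⟨i, rfl⟩ := hsurj c hc
    refine e.le_iff_le.2 ?_
    have := e.lt_iff_lt.1 hlt
    simp only [Fin.lt_def, Fin.le_def] at this ⊢
    omega

theorem exists_dvd_lt_mul_le {z c d s : ℕ} (hs : ∀ p, p.Prime → p ∣ s → p ≤ z)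
    (hc : c ≤ d) (hd : d < c * s) : ∃ e, e ∣ s ∧ d < c * e ∧ c * e ≤ d * z := by
  induction s using induction_on_primes with
  | zero => omega
  | one => omega
  | prime_mul p t hp ih =>
    rcases lt_or_ge d (c * t) with h | h
    · obtain ⟨e, he, h1, h2⟩ := ih (fun q hq hqt ↦ hs q hq (hqt.mul_left p)) h
      exact ⟨e, he.mul_left p, h1, h2⟩
    · refine ⟨p * t, dvd_rfl, hd, ?_⟩
      calc c * (p * t) = c * t * p := by ring
        _ ≤ d * z := Nat.mul_le_mul h (hs p hp (dvd_mul_right p t))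

theorem exists_good_split {n d : ℕ} (hn : n ≠ 0) (hd : 1 ≤ d) (hdn : d < n) :
    ∃ s z m, z.Prime ∧ n = s * z * m ∧ (∀ p, p.Prime → p ∣ s → p < z) ∧
      (∀ p, p.Prime → p ∣ m → z ≤ p) ∧ (∀ c, c ∣ z * m → c ≤ d → c * s ≤ d) ∧
      ∃ e, e ∣ n ∧ d < e ∧ e ≤ d * z := by
  let P : ℕ → Prop := fun w ↦ ∃ s r, n = s * r ∧ (∀ p, p.Prime → p ∣ s → p < w) ∧
    (∀ p, p.Prime → p ∣ r → w ≤ p) ∧ ∀ c, c ∣ r → c ≤ d → c * s ≤ d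
  have h0 : P 0 := ⟨1, n, by simp, fun p hp h ↦ absurd (Nat.dvd_one.1 h) hp.ne_one,
    by simp, by simp⟩
  have hlast : ¬ P (n + 1) := by
    rintro ⟨s, r, rfl, -, hr, hg⟩
    have hr1 : r = 1 := by
      by_contra hne
      obtain ⟨p, hp, hpr⟩ := Nat.exists_prime_and_dvd hne
      have h1 := hr p hp hpr
      have h2 := Nat.le_of_dvd (Nat.pos_of_ne_zero hn) (hpr.trans (dvd_mul_left r s))
      omega
    subst hr1
    have := hg 1 dvd_rfl hd
    omega
  obtain ⟨z, hz, hz'⟩ : ∃ w, P w ∧ ¬ P (w + 1) := by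
    by_contra! h
    exact hlast (Nat.rec h0 (fun w hw ↦ h w hw) (n + 1))
  obtain ⟨s, r, rfl, hs, hr, hg⟩ := hz
  have hzr : z.Prime ∧ z ∣ r := by
    by_contra hcon
    refine hz' ⟨s, r, rfl, fun p hp h ↦ (hs p hp h).trans (Nat.lt_succ_self z),
      fun p hp h ↦ ?_, hg⟩
    rcases (hr p hp h).eq_or_lt with rfl | hlt
    · exact absurd ⟨hp, h⟩ hcon
    · exact hlt
  obtain ⟨hzp, m, rfl⟩ := hzr
  refine ⟨s, z, m, hzp, by ring, hs, fun p hp h ↦ hr p hp (h.mul_left z), hg, ?_⟩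
  have hm0 : z * m ≠ 0 := right_ne_zero_of_mul hn
  obtain ⟨k, r', hr', hkr⟩ := Nat.exists_eq_pow_mul_and_not_dvd hm0 z hzp.ne_one
  have hsmooth : ∀ p, p.Prime → p ∣ s * z ^ k → p ≤ z := fun p hp h ↦ by
    rcases (Nat.Prime.dvd_mul hp).1 h with h | h
    · exact (hs p hp h).le
    · exact ((Nat.prime_dvd_prime_iff_eq hp hzp).1 (hp.dvd_of_dvd_pow h)).le
  have hbad : ∃ c, c ∣ r' ∧ c ≤ d ∧ d < c * (s * z ^ k) := by
    by_contra! hcon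
    refine hz' ⟨s * z ^ k, r', by rw [hkr]; ring,
      fun p hp h ↦ Nat.lt_succ_of_le (hsmooth p hp h), fun p hp h ↦ ?_, hcon⟩
    have h1 : z ≤ p := hr p hp (hkr ▸ h.mul_left _)
    rcases h1.eq_or_lt with rfl | hlt
    · exact absurd h hr'
    · exact hlt
  obtain ⟨c, hcr, hcd, hdc⟩ := hbad
  obtain ⟨e, he, h1, h2⟩ := exists_dvd_lt_mul_le hsmooth hcd hdc
  refine ⟨c * e, ?_, h1, h2⟩
  rw [hkr, show s * (z ^ k * r') = r' * (s * z ^ k) by ring]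
  exact mul_dvd_mul hcr he

theorem card_divisors_dvd_card_filter {s r d : ℕ} (hs : s ≠ 0) (hr : r ≠ 0) (hsr : s.Coprime r)
    (hg : ∀ c, c ∣ r → c ≤ d → c * s ≤ d) :
    s.divisors.card ∣ ((s * r).divisors.filter (· ≤ d)).card := by
  have : (s * r).divisors.filter (· ≤ d) =
      (s.divisors ×ˢ r.divisors.filter (· ≤ d)).image (fun x ↦ x.1 * x.2) := by
    ext c
    simp only [Finset.mem_filter, Finset.mem_image, Finset.mem_product, Nat.mem_divisors,
      Prod.exists]
    constructor
    · rintro ⟨⟨hc, -⟩, hcd⟩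
      obtain ⟨a, b, ha, hb, rfl⟩ := (Nat.dvd_mul).1 hc
      refine ⟨a, b, ⟨⟨ha, hs⟩, ⟨hb, hr⟩, ?_⟩, rfl⟩
      exact (Nat.le_mul_of_pos_left b (Nat.pos_of_dvd_of_pos ha (Nat.pos_of_ne_zero hs))).trans hcd
    · rintro ⟨a, b, ⟨⟨ha, -⟩, ⟨hb, -⟩, hbd⟩, rfl⟩
      refine ⟨⟨mul_dvd_mul ha hb, mul_ne_zero hs hr⟩, ?_⟩
      calc a * b ≤ s * b := Nat.mul_le_mul_right b (Nat.le_of_dvd (Nat.pos_of_ne_zero hs) ha)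
        _ = b * s := mul_comm _ _
        _ ≤ d := hg b hb hbd
  rw [this, Finset.card_image_of_injOn, Finset.card_product]
  · exact dvd_mul_right _ _
  · rintro ⟨a, b⟩ h ⟨a', b'⟩ h' heq
    simp only [Finset.coe_product, Finset.coe_filter, Set.mem_prod, Finset.mem_coe,
      Nat.mem_divisors, Set.mem_ofPred_eq] at h h' heq
    have hab : ∀ {a b a' b' : ℕ}, a ∣ s → b' ∣ r → a * b = a' * b' → a ∣ a' :=
      fun ha hb h ↦ ((hsr.coprime_dvd_left ha).coprime_dvd_right hb).dvd_of_dvd_mul_right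
        (h ▸ dvd_mul_right _ _)
    have haa : a = a' := Nat.dvd_antisymm (hab h.1.1 h'.2.1.1 heq) (hab h'.1.1 h.2.1.1 heq.symm)
    subst haa
    have ha0 : 0 < a := Nat.pos_of_dvd_of_pos h.1.1 (Nat.pos_of_ne_zero hs)
    exact Prod.ext rfl (Nat.eq_of_mul_eq_mul_left ha0 heq)

theorem coprime_of_primes_separated {a b z : ℕ} (ha : ∀ p, p.Prime → p ∣ a → p < z)
    (hb : ∀ p, p.Prime → p ∣ b → z ≤ p) : a.Coprime b :=
  Nat.Coprime.symm <| Nat.coprime_of_dvd fun p hp hpb hpa ↦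
    (ha p hp hpa).not_ge (hb p hp hpb)

theorem exists_split_dth {n ℓ : ℕ} (hℓ : 1 ≤ ℓ) (h : ℓ + 1 ≤ n.divisors.card) :
    ∃ s z m, z.Prime ∧ n = s * z * m ∧ (∀ p, p.Prime → p ∣ s → p < z) ∧
      (∀ p, p.Prime → p ∣ m → z ≤ p) ∧ s.divisors.card ∣ ℓ ∧
      0 < dth n ℓ ∧ dth n (ℓ + 1) ≤ dth n ℓ * z := by
  obtain ⟨h1, h2, h3, h4, h5⟩ := dth_consecutive hℓ h
  have hn : n ≠ 0 := (Nat.mem_divisors.1 h1).2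
  have hpos : 0 < dth n ℓ := Nat.pos_of_mem_divisors h1
  obtain ⟨s, z, m, hz, hnszm, hs, hm, hg, e, hen, hde, hez⟩ :=
    exists_good_split hn hpos (h3.trans_le (Nat.divisor_le h2))
  refine ⟨s, z, m, hz, hnszm, hs, hm, ?_, hpos,
    (h5 e (Nat.mem_divisors.2 ⟨hen, hn⟩) hde).trans hez⟩
  have hne : s * (z * m) ≠ 0 := by rw [← mul_assoc, ← hnszm]; exact hn
  have hcop : s.Coprime (z * m) := coprime_of_primes_separated hs fun p hp hd ↦ by
    rcases (Nat.Prime.dvd_mul hp).1 hd with hd | hd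
    · exact ((Nat.prime_dvd_prime_iff_eq hp hz).1 hd).ge
    · exact hm p hp hd
  have := card_divisors_dvd_card_filter (left_ne_zero_of_mul hne) (right_ne_zero_of_mul hne)
    hcop hg
  rwa [← mul_assoc, ← hnszm, h4] at this

theorem card_primeFactors_le_of_card_divisors_dvd {a b ℓ : ℕ} (hb : b ≠ 0) (ha : Squarefree a)
    (hℓ : ℓ ≠ 0) (h : (b ^ 2 * a).divisors.card ∣ ℓ) : a.primeFactors.card ≤ padicValNat 2 ℓ := by
  have hne : b ^ 2 * a ≠ 0 := mul_ne_zero (pow_ne_zero 2 hb) ha.ne_zero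
  rw [← padicValNat_dvd_iff_le hℓ]
  refine dvd_trans ?_ h
  rw [Nat.card_divisors hne, ← Finset.prod_const]
  refine (Finset.prod_dvd_prod_of_dvd _ _ fun p hp ↦ ?_).trans (Finset.prod_dvd_prod_of_subset _ _ _
    (Nat.primeFactors_mono (dvd_mul_left a (b ^ 2)) hne))
  have h1 : a.factorization p = 1 :=
    Nat.factorization_eq_one_of_squarefree ha (Nat.prime_of_mem_primeFactors hp)
      (Nat.dvd_of_mem_primeFactors hp)
  rw [Nat.factorization_mul (pow_ne_zero 2 hb) ha.ne_zero, Nat.factorization_pow]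
  simp only [Finsupp.coe_add, Finsupp.coe_smul, Pi.add_apply, Pi.smul_apply, smul_eq_mul, h1]
  omega

theorem prod_primesBelow_pow_div_dvd_factorial (n : ℕ) :
    ∏ p ∈ (n + 1).primesBelow, p ^ (n / p) ∣ n.factorial := by
  refine Finset.prod_dvd_of_isRelPrime (fun p hp q hq hpq ↦ ?_) fun p hp ↦ ?_
  · rw [Function.onFun, ← Nat.coprime_iff_isRelPrime]
    exact Nat.Coprime.pow _ _ ((Nat.coprime_primes (Nat.prime_of_mem_primesBelow hp)
      (Nat.prime_of_mem_primesBelow hq)).2 hpq)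
  · have hp0 : 0 < p := (Nat.prime_of_mem_primesBelow hp).pos
    obtain ⟨k, hk⟩ : ∃ k, k = n / p := ⟨_, rfl⟩
    rw [← hk]
    have hkn : k * p ≤ n := hk ▸ Nat.div_mul_le_self n p
    clear hk
    refine dvd_trans ?_ (Nat.factorial_dvd_factorial hkn)
    clear hkn
    induction k with
    | zero => simp
    | succ k ih =>
      rw [pow_succ]
      have h1 : (k * p).factorial * p ∣ ((k + 1) * p).factorial := by
        obtain ⟨m, hm⟩ : ∃ m, (k + 1) * p = m + 1 := ⟨(k + 1) * p - 1, by
          have := Nat.mul_pos (Nat.succ_pos k) hp0; simp only [Nat.succ_eq_add_one] at this; omega⟩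
        rw [hm, Nat.factorial_succ, mul_comm]
        refine mul_dvd_mul ⟨k + 1, by rw [← hm, mul_comm]⟩ (Nat.factorial_dvd_factorial ?_)
        have : (k + 1) * p = k * p + p := by ring
        omega
      exact (mul_dvd_mul_right ih p).trans h1

theorem sum_primesBelow_log_div_le {n : ℕ} (hn : 1 ≤ n) :
    ∑ p ∈ (n + 1).primesBelow, Real.log p / p ≤ 2 * Real.log n := by
  have hn0 : (0 : ℝ) < n := by exact_mod_cast hn
  have h1 : ∑ p ∈ (n + 1).primesBelow, ((n / p : ℕ) : ℝ) * Real.log p ≤ n * Real.log n := by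
    have h2 : ∏ p ∈ (n + 1).primesBelow, p ^ (n / p) ≤ n ^ n :=
      (Nat.le_of_dvd n.factorial_pos (prod_primesBelow_pow_div_dvd_factorial n)).trans
        n.factorial_le_pow
    have hpos : ∀ p ∈ (n + 1).primesBelow, ((p : ℝ) ^ (n / p)) ≠ 0 := fun p hp ↦
      pow_ne_zero _ (by exact_mod_cast (Nat.prime_of_mem_primesBelow hp).ne_zero)
    have h3 : (∏ p ∈ (n + 1).primesBelow, (p : ℝ) ^ (n / p)) ≤ (n : ℝ) ^ n := by exact_mod_cast h2
    have h4 := Real.log_le_log ((Finset.prod_nonneg fun p _ ↦ by positivity).lt_of_ne'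
      (Finset.prod_ne_zero_iff.2 hpos)) h3
    rw [Real.log_prod hpos, Real.log_pow] at h4
    simpa only [Real.log_pow] using h4
  have h5 : ∀ p ∈ (n + 1).primesBelow, Real.log p / p ≤
      2 / n * (((n / p : ℕ) : ℝ) * Real.log p) := fun p hp ↦ by
    have hp1 := (Nat.prime_of_mem_primesBelow hp).pos
    have hp2 : p ≤ n := Nat.lt_succ_iff.1 (Nat.lt_of_mem_primesBelow hp)
    have hp0 : (0 : ℝ) < p := by exact_mod_cast hp1
    have hlog : 0 ≤ Real.log p := Real.log_natCast_nonneg p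
    have h6 : (n : ℝ) ≤ 2 * (n / p : ℕ) * p := by
      have h7 : 1 ≤ n / p := Nat.div_pos hp2 hp1
      have h8 : n < (n / p + 1) * p := by
        have h9 := Nat.div_add_mod n p
        have h10 := Nat.mod_lt n hp1
        nlinarith
      have : n ≤ 2 * (n / p) * p := by nlinarith
      exact_mod_cast this
    have h11 : (1 : ℝ) / p ≤ 2 / n * (n / p : ℕ) := by
      rw [div_mul_eq_mul_div, div_le_div_iff₀ hp0 hn0]
      linarith
    calc Real.log p / p = 1 / p * Real.log p := by ring
      _ ≤ 2 / n * (n / p : ℕ) * Real.log p := by gcongr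
      _ = _ := by ring
  calc _ ≤ ∑ p ∈ (n + 1).primesBelow, 2 / n * (((n / p : ℕ) : ℝ) * Real.log p) :=
        Finset.sum_le_sum h5
    _ = 2 / n * ∑ p ∈ (n + 1).primesBelow, ((n / p : ℕ) : ℝ) * Real.log p := by
        rw [Finset.mul_sum]
    _ ≤ 2 / n * (n * Real.log n) := by gcongr
    _ = 2 * Real.log n := by field_simp

theorem sum_rpow_neg_one_sub_le {η : ℝ} (hη : 0 < η) {A : Finset ℕ} (hA : ∀ n ∈ A, n ≠ 0) :
    ∑ n ∈ A, (n : ℝ) ^ (-1 - η) ≤ 1 + 1 / η := by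
  have key : ∀ N : ℕ, ∑ k ∈ Finset.range (N + 1), ((k + 1 : ℕ) : ℝ) ^ (-1 - η) ≤
      1 + 1 / η - 1 / η * ((N + 1 : ℕ) : ℝ) ^ (-η) := by
    intro N
    induction N with
    | zero => simp
    | succ N ih =>
      rw [Finset.sum_range_succ]
      have hN : (0 : ℝ) < ((N + 1 : ℕ) : ℝ) := by positivity
      have hM : (0 : ℝ) < ((N + 1 + 1 : ℕ) : ℝ) := by positivity
      set a : ℝ := ((N + 1 : ℕ) : ℝ) with ha
      set b : ℝ := ((N + 1 + 1 : ℕ) : ℝ) with hb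
      have hab : b = a + 1 := by rw [ha, hb]; push_cast; ring
      have h1 : 1 / b ≤ Real.log (b / a) := by
        have := Real.one_sub_inv_le_log_of_pos (div_pos hM hN)
        refine le_trans (le_of_eq ?_) this
        rw [inv_div, hab]; field_simp; ring
      have h2 : b ^ (-η) * (1 + η / b) ≤ a ^ (-η) := by
        have h3 : a ^ (-η) = b ^ (-η) * (b / a) ^ η := by
          rw [Real.div_rpow hM.le hN.le, Real.rpow_neg hM.le, Real.rpow_neg hN.le]
          have := (Real.rpow_pos_of_pos hM η).ne'
          field_simp
        rw [h3]
        gcongr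
        rw [Real.rpow_def_of_pos (div_pos hM hN)]
        refine le_trans ?_ (Real.add_one_le_exp _)
        have : η / b = 1 / b * η := by ring
        rw [this, add_comm]
        gcongr
      have h4 : b ^ (-1 - η) = b ^ (-η) * (1 / b) := by
        rw [show -1 - η = -η - 1 by ring, Real.rpow_sub_one hM.ne']; ring
      rw [h4]
      have h5 : 1 / η * (b ^ (-η) * (1 + η / b)) ≤ 1 / η * a ^ (-η) := by gcongr
      have h6 : 1 / η * (b ^ (-η) * (1 + η / b)) = 1 / η * b ^ (-η) + b ^ (-η) * (1 / b) := by
        field_simp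
      linarith
  have hsub : A ⊆ (Finset.range (A.sup id + 1)).image (· + 1) := fun n hn ↦ by
    have h1 : n ≤ A.sup id := Finset.le_sup (f := id) hn
    have h2 := hA n hn
    exact Finset.mem_image.2 ⟨n - 1, Finset.mem_range.2 (by omega), by omega⟩
  calc _ ≤ ∑ n ∈ (Finset.range (A.sup id + 1)).image (· + 1), ((n : ℕ) : ℝ) ^ (-1 - η) :=
        Finset.sum_le_sum_of_subset_of_nonneg hsub fun _ _ _ ↦ by positivity
    _ = ∑ k ∈ Finset.range (A.sup id + 1), ((k + 1 : ℕ) : ℝ) ^ (-1 - η) :=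
        Finset.sum_image fun _ _ _ _ h ↦ by simpa using h
    _ ≤ 1 + 1 / η - 1 / η * ((A.sup id + 1 : ℕ) : ℝ) ^ (-η) := key _
    _ ≤ 1 + 1 / η := sub_le_self _ (by positivity)

/-- The map `n ↦ n ^ a` from natural to real numbers, as a monoid homomorphism. -/
noncomputable def natRpowHom (a : ℝ) : ℕ →* ℝ where
  toFun n := (n : ℝ) ^ a
  map_one' := by simp
  map_mul' m n := by push_cast; exact Real.mul_rpow m.cast_nonneg n.cast_nonneg

theorem hasSum_smoothNumbers_rpow {a : ℝ} (ha : a < 0) (N : ℕ) :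
    HasSum (fun m : N.smoothNumbers ↦ ((m : ℕ) : ℝ) ^ a)
      (∏ p ∈ N.primesBelow, (1 - (p : ℝ) ^ a)⁻¹) := by
  refine (EulerProduct.summable_and_hasSum_smoothNumbers_prod_primesBelow_geometric
    (f := natRpowHom a) (fun {p} hp ↦ ?_) N).2
  have h : natRpowHom a p = (p : ℝ) ^ a := rfl
  rw [h, Real.norm_of_nonneg (by positivity)]
  exact Real.rpow_lt_one_of_one_lt_of_neg (by exact_mod_cast hp.one_lt) ha

theorem sum_smooth_rpow_le_prod {a : ℝ} (ha : a < 0) {N : ℕ} {A : Finset ℕ}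
    (hA : ∀ n ∈ A, n ∈ N.smoothNumbers) :
    ∑ n ∈ A, (n : ℝ) ^ a ≤ ∏ p ∈ N.primesBelow, (1 - (p : ℝ) ^ a)⁻¹ := by
  have := sum_le_hasSum (A.subtype (· ∈ N.smoothNumbers))
    (fun _ _ ↦ by positivity) (hasSum_smoothNumbers_rpow ha N)
  refine le_trans (le_of_eq ?_) this
  rw [Finset.sum_subtype_of_mem (fun n : ℕ ↦ (n : ℝ) ^ a) hA]

theorem prod_primesBelow_le_of_pos {η : ℝ} (hη : 0 < η) (N : ℕ) :
    ∏ p ∈ N.primesBelow, (1 - (p : ℝ) ^ (-1 - η))⁻¹ ≤ 1 + 1 / η := by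
  refine hasSum_le_of_sum_le (hasSum_smoothNumbers_rpow (by linarith) N) fun s ↦ ?_
  have := sum_rpow_neg_one_sub_le hη (A := s.map (Function.Embedding.subtype _)) (by
    intro n hn
    obtain ⟨m, -, rfl⟩ := Finset.mem_map.1 hn
    exact Nat.ne_zero_of_mem_smoothNumbers m.2)
  simpa using this

theorem rpow_log_inv_le {p y : ℝ} (hp : 0 < p) (hpy : p ≤ y) (hy : 1 < y) {c : ℝ} (hc : 0 ≤ c) :
    p ^ (c / Real.log y) ≤ Real.exp c := by
  rw [Real.rpow_def_of_pos hp, Real.exp_le_exp]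
  have hL : 0 < Real.log y := Real.log_pos hy
  have := Real.log_le_log hp hpy
  calc Real.log p * (c / Real.log y) = Real.log p / Real.log y * c := by ring
    _ ≤ 1 * c := by gcongr; exact (div_le_one hL).2 this
    _ = c := one_mul c

theorem exp_quarter_lt : Real.exp (1 / 4) < 4 / 3 := by
  have h := Real.exp_one_lt_d9
  have h1 : Real.exp (1 / 4) ^ 4 = Real.exp 1 := by rw [← Real.exp_nat_mul]; norm_num
  by_contra! hcon
  have : (4 / 3 : ℝ) ^ 4 ≤ Real.exp (1 / 4) ^ 4 := by gcongr
  norm_num at this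
  linarith

theorem rpow_prime_weight_le {p : ℕ} {y : ℝ} (hp : p.Prime) (hpy : (p : ℝ) ≤ y) (hy : 1 < y) :
    (p : ℝ) ^ (1 / 4 / Real.log y - 1) ≤ 4 / 3 / p := by
  have hp0 : (0 : ℝ) < p := by exact_mod_cast hp.pos
  rw [Real.rpow_sub_one hp0.ne']
  gcongr
  exact (rpow_log_inv_le hp0 hpy hy (by norm_num)).trans exp_quarter_lt.le

theorem euler_factor_le {p : ℕ} {y : ℝ} (hp : p.Prime) (hpy : (p : ℝ) ≤ y) (hy : 1 < y) :
    (1 - (p : ℝ) ^ (1 / 4 / Real.log y - 1))⁻¹ ≤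
      (1 - (p : ℝ) ^ (-1 - 1 / Real.log y))⁻¹ *
        Real.exp (30 / Real.log y * (Real.log p / p)) := by
  have hp0 : (0 : ℝ) < p := by exact_mod_cast hp.pos
  have hp2 : (2 : ℝ) ≤ p := by exact_mod_cast hp.two_le
  have hL : 0 < Real.log y := Real.log_pos hy
  set L := Real.log y with hLdef
  set u := (p : ℝ) ^ (1 / 4 / L - 1) with hu
  set v := (p : ℝ) ^ (-1 - 1 / L) with hv
  have hu1 : u ≤ 2 / 3 := (rpow_prime_weight_le hp hpy hy).trans (by
    rw [div_le_iff₀ hp0]; linarith)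
  have hv1 : v < 1 := Real.rpow_lt_one_of_one_lt_of_neg (by linarith)
    (by have := div_pos one_pos hL; linarith)
  have hlogp : 0 < Real.log p := Real.log_pos (by linarith)
  set θ := Real.log p * (5 / 4 / L) with hθ
  have hθ0 : 0 ≤ θ := by positivity
  have hθ1 : θ ≤ 5 / 4 := by
    have := Real.log_le_log hp0 hpy
    calc θ = Real.log p / L * (5 / 4) := by rw [hθ]; ring
      _ ≤ 1 * (5 / 4) := by gcongr; exact (div_le_one hL).2 this
      _ = _ := one_mul _
  have huv : u = v * Real.exp θ := by
    rw [hθ, ← Real.rpow_def_of_pos hp0, hu, hv, ← Real.rpow_add hp0]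
    congr 1; field_simp; ring
  have hvp : v ≤ 1 / p := by
    rw [one_div, ← Real.rpow_neg_one]
    exact Real.rpow_le_rpow_of_exponent_le (by linarith)
      (by have := div_pos one_pos hL; linarith)
  have hexp : Real.exp θ - 1 ≤ 8 * θ := by
    have h1 : 1 - θ ≤ Real.exp (-θ) := Real.one_sub_le_exp_neg θ
    have h2 : Real.exp (-θ) * Real.exp θ = 1 := by rw [← Real.exp_add]; simp
    have h3 : Real.exp θ ≤ 8 := by
      calc Real.exp θ ≤ Real.exp 2 := Real.exp_le_exp.2 (by linarith)
        _ = Real.exp 1 ^ 2 := by rw [← Real.exp_nat_mul]; norm_num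
        _ ≤ 2.7182818286 ^ 2 := by gcongr; exact Real.exp_one_lt_d9.le
        _ ≤ 8 := by norm_num
    have h4 := Real.exp_pos θ
    nlinarith
  have hdiff : u - v ≤ 10 / L * (Real.log p / p) := by
    calc u - v = v * (Real.exp θ - 1) := by rw [huv]; ring
      _ ≤ 1 / p * (8 * θ) := by
          gcongr
          have := Real.one_le_exp hθ0; linarith
      _ = 10 / L * (Real.log p / p) := by rw [hθ]; ring
  have hstep : (1 - v) ≤ (1 - u) * Real.exp (30 / L * (Real.log p / p)) := by
    have h1 := Real.add_one_le_exp (30 / L * (Real.log p / p))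
    have h2 : (1 - u) * (30 / L * (Real.log p / p) + 1) ≤
        (1 - u) * Real.exp (30 / L * (Real.log p / p)) := by
      gcongr; linarith
    have h3 : 0 ≤ 10 / L * (Real.log p / p) := by positivity
    have h4 : 30 / L * (Real.log p / p) = 3 * (10 / L * (Real.log p / p)) := by ring
    rw [h4] at h2 ⊢
    nlinarith
  rw [← div_eq_inv_mul, le_div_iff₀ (by linarith), inv_mul_le_iff₀ (by linarith)]
  exact hstep

theorem primesBelow_floor_le {p : ℕ} {y : ℝ} (hp : p ∈ (⌊y⌋₊ + 1).primesBelow) : (p : ℝ) ≤ y :=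
  (Nat.le_floor_iff' (Nat.prime_of_mem_primesBelow hp).ne_zero).1
    (Nat.lt_succ_iff.1 (Nat.lt_of_mem_primesBelow hp))

theorem one_lt_log_of_four_le {y : ℝ} (hy : 4 ≤ y) : 1 < Real.log y := by
  rw [Real.lt_log_iff_exp_lt (by linarith)]
  linarith [Real.exp_one_lt_d9]

theorem weight_exponent_neg {y : ℝ} (hy : 4 ≤ y) : 1 / 4 / Real.log y - 1 < 0 := by
  have hL := one_lt_log_of_four_le hy
  have : 1 / 4 / Real.log y < 1 := by rw [div_lt_one (by linarith)]; linarith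
  linarith

theorem exists_euler_product_le :
    ∃ K : ℝ, 1 ≤ K ∧ ∀ y : ℝ, 4 ≤ y →
      ∏ p ∈ (⌊y⌋₊ + 1).primesBelow, (1 - (p : ℝ) ^ (1 / 4 / Real.log y - 1))⁻¹ ≤
        K * Real.log y := by
  refine ⟨2 * Real.exp 60, by linarith [Real.add_one_le_exp (60 : ℝ)], fun y hy ↦ ?_⟩
  have hL := one_lt_log_of_four_le hy
  have hfl : 1 ≤ ⌊y⌋₊ := Nat.le_floor (by push_cast; linarith)
  have hprime : ∀ p ∈ (⌊y⌋₊ + 1).primesBelow, p.Prime := fun p ↦ Nat.prime_of_mem_primesBelow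
  have hone : ∀ p ∈ (⌊y⌋₊ + 1).primesBelow, ∀ a : ℝ, a < 0 → 0 < (1 - (p : ℝ) ^ a)⁻¹ :=
    fun p hp a ha ↦ inv_pos.2 (sub_pos.2 (Real.rpow_lt_one_of_one_lt_of_neg
      (by exact_mod_cast (hprime p hp).one_lt) ha))
  have ha := weight_exponent_neg hy
  have hη : 0 < 1 / Real.log y := by positivity
  calc _ ≤ ∏ p ∈ (⌊y⌋₊ + 1).primesBelow, ((1 - (p : ℝ) ^ (-1 - 1 / Real.log y))⁻¹ *
        Real.exp (30 / Real.log y * (Real.log p / p))) :=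
        Finset.prod_le_prod (fun p hp ↦ (hone p hp _ ha).le) fun p hp ↦
          euler_factor_le (hprime p hp) (primesBelow_floor_le hp) (by linarith)
    _ = (∏ p ∈ (⌊y⌋₊ + 1).primesBelow, (1 - (p : ℝ) ^ (-1 - 1 / Real.log y))⁻¹) *
        Real.exp (30 / Real.log y * ∑ p ∈ (⌊y⌋₊ + 1).primesBelow, Real.log p / p) := by
        rw [Finset.prod_mul_distrib, Finset.mul_sum, Real.exp_sum]
    _ ≤ (1 + 1 / (1 / Real.log y)) * Real.exp (30 / Real.log y * (2 * Real.log y)) := by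
        gcongr
        · exact prod_primesBelow_le_of_pos hη _
        · refine (sum_primesBelow_log_div_le hfl).trans ?_
          gcongr
          exact Nat.floor_le (by linarith)
    _ = (1 + Real.log y) * Real.exp 60 := by
        congr 1
        · simp
        · congr 1; field_simp; norm_num
    _ ≤ 2 * Real.exp 60 * Real.log y := by nlinarith [Real.exp_pos 60]

theorem exists_sum_smooth_le :
    ∃ K : ℝ, 1 ≤ K ∧ ∀ y : ℝ, 4 ≤ y → ∀ A : Finset ℕ,
      (∀ n ∈ A, ∀ p, p.Prime → p ∣ n → (p : ℝ) ≤ y) →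
      ∑ n ∈ A, (n : ℝ) ^ (1 / 4 / Real.log y - 1) ≤ K * Real.log y := by
  obtain ⟨K, hK1, hK⟩ := exists_euler_product_le
  refine ⟨K, hK1, fun y hy A hA ↦ (sum_smooth_rpow_le_prod ?_ fun n hn ↦ ?_).trans (hK y hy)⟩
  · exact weight_exponent_neg hy
  · exact Nat.mem_smoothNumbers'.2 fun p hp h ↦ Nat.lt_succ_of_le (Nat.le_floor (hA n hn p hp h))

theorem log_log_four_pos : 0 < Real.log (Real.log 4) :=
  Real.log_pos (one_lt_log_of_four_le le_rfl)

theorem log_log_four_le {y : ℝ} (hy : 4 ≤ y) : Real.log (Real.log 4) ≤ Real.log (Real.log y) :=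
  Real.log_le_log (by linarith [one_lt_log_of_four_le le_rfl])
    (Real.log_le_log (by norm_num) hy)

theorem exists_sum_primes_le :
    ∃ K : ℝ, 0 < K ∧ ∀ y : ℝ, 4 ≤ y → 1 ≤ K * Real.log (Real.log y) ∧
      ∑ p ∈ (⌊y⌋₊ + 1).primesBelow, (p : ℝ) ^ (1 / 4 / Real.log y - 1) ≤
        K * Real.log (Real.log y) := by
  obtain ⟨K, hK1, hK⟩ := exists_euler_product_le
  have hc := log_log_four_pos
  set c := Real.log (Real.log 4)
  have hlogK : 0 ≤ Real.log K := Real.log_nonneg hK1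
  refine ⟨(1 + Real.log K) / c + 1, by positivity, fun y hy ↦ ?_⟩
  have hcy : c ≤ Real.log (Real.log y) := log_log_four_le hy
  have hL := one_lt_log_of_four_le hy
  have hmul : 1 + Real.log K + Real.log (Real.log y) ≤
      ((1 + Real.log K) / c + 1) * Real.log (Real.log y) := by
    have : 1 + Real.log K ≤ (1 + Real.log K) / c * Real.log (Real.log y) := by
      rw [div_mul_eq_mul_div, le_div_iff₀ hc]
      gcongr
    linarith
  refine ⟨by linarith, ?_⟩
  have hexp : Real.exp (∑ p ∈ (⌊y⌋₊ + 1).primesBelow, (p : ℝ) ^ (1 / 4 / Real.log y - 1)) ≤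
      K * Real.log y := by
    rw [Real.exp_sum]
    refine le_trans (Finset.prod_le_prod (fun _ _ ↦ (Real.exp_pos _).le) fun p hp ↦ ?_) (hK y hy)
    have h1 : (p : ℝ) ^ (1 / 4 / Real.log y - 1) < 1 := Real.rpow_lt_one_of_one_lt_of_neg
      (by exact_mod_cast (Nat.prime_of_mem_primesBelow hp).one_lt) (weight_exponent_neg hy)
    rw [← inv_inv (Real.exp _), ← Real.exp_neg]
    exact inv_anti₀ (by linarith) (Real.one_sub_le_exp_neg _)
  have := Real.log_le_log (Real.exp_pos _) hexp
  rw [Real.log_exp, Real.log_mul (by positivity) (by positivity)] at this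
  linarith

theorem exists_sum_rough_le :
    ∃ K : ℝ, 1 ≤ K ∧ ∀ y : ℝ, 4 ≤ y → ∀ z : ℕ, 1 ≤ z → (z : ℝ) ≤ y → ∀ M : Finset ℕ,
      (∀ n ∈ M, ∀ p, p.Prime → p ∣ n → z ≤ p ∧ (p : ℝ) ≤ y) →
      Real.log z * ∑ n ∈ M, (n : ℝ) ^ (1 / 4 / Real.log y - 1) ≤ K * Real.log y := by
  obtain ⟨K, hK1, hK⟩ := exists_sum_smooth_le
  refine ⟨K, hK1, fun y hy z hz hzy M hM ↦ ?_⟩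
  set a := 1 / 4 / Real.log y - 1 with ha
  have ha1 : -1 ≤ a := by
    have := one_lt_log_of_four_le hy
    have : 0 < 1 / 4 / Real.log y := by positivity
    linarith
  have hk : ∀ k ∈ Finset.Icc 1 (z - 1), ∀ p, p.Prime → p ∣ k → p < z := fun k hk p hp h ↦ by
    have := Finset.mem_Icc.1 hk
    have := Nat.le_of_dvd (by omega) h
    omega
  have hlog : Real.log z ≤ ∑ k ∈ Finset.Icc 1 (z - 1), (k : ℝ) ^ a := by
    have h1 := log_add_one_le_harmonic (z - 1)
    rw [Nat.sub_add_cancel hz, harmonic_eq_sum_Icc] at h1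
    push_cast at h1
    refine h1.trans (Finset.sum_le_sum fun k hk ↦ ?_)
    rw [← Real.rpow_neg_one]
    exact Real.rpow_le_rpow_of_exponent_le (by exact_mod_cast (Finset.mem_Icc.1 hk).1) ha1
  have hinj : Set.InjOn (fun x : ℕ × ℕ ↦ x.1 * x.2) (Finset.Icc 1 (z - 1) ×ˢ M : Finset _) := by
    rintro ⟨k, m⟩ h ⟨k', m'⟩ h' heq
    simp only [Finset.coe_product, Set.mem_prod, Finset.mem_coe] at h h' heq
    have hdvd : ∀ {k m k' m' : ℕ}, k ∈ Finset.Icc 1 (z - 1) → m' ∈ M → k * m = k' * m' → k ∣ k' :=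
      fun h1 h2 h3 ↦ (coprime_of_primes_separated (hk _ h1)
        fun p hp h ↦ (hM _ h2 p hp h).1).dvd_of_dvd_mul_right (h3 ▸ dvd_mul_right _ _)
    obtain rfl : k = k' := Nat.dvd_antisymm (hdvd h.1 h'.2 heq) (hdvd h'.1 h.2 heq.symm)
    exact Prod.ext rfl (Nat.eq_of_mul_eq_mul_left (Finset.mem_Icc.1 h.1).1 heq)
  calc Real.log z * ∑ n ∈ M, (n : ℝ) ^ a
      ≤ (∑ k ∈ Finset.Icc 1 (z - 1), (k : ℝ) ^ a) * ∑ n ∈ M, (n : ℝ) ^ a := by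
        gcongr
    _ = ∑ x ∈ Finset.Icc 1 (z - 1) ×ˢ M, ((x.1 * x.2 : ℕ) : ℝ) ^ a := by
        rw [Finset.sum_mul_sum, ← Finset.sum_product']
        refine Finset.sum_congr rfl fun x _ ↦ ?_
        rw [Nat.cast_mul, Real.mul_rpow (Nat.cast_nonneg _) (Nat.cast_nonneg _)]
    _ = ∑ n ∈ (Finset.Icc 1 (z - 1) ×ˢ M).image (fun x : ℕ × ℕ ↦ x.1 * x.2), ((n : ℕ) : ℝ) ^ a :=
        (Finset.sum_image (f := fun n : ℕ ↦ (n : ℝ) ^ a) hinj).symm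
    _ ≤ K * Real.log y := by
        refine hK y hy _ fun n hn p hp h ↦ ?_
        obtain ⟨⟨k, m⟩, hx, rfl⟩ := Finset.mem_image.1 hn
        rw [Finset.mem_product] at hx
        rcases (Nat.Prime.dvd_mul hp).1 h with h | h
        · exact (Nat.cast_le.2 (hk k hx.1 p hp h).le).trans hzy
        · exact (hM m hx.2 p hp h).2

theorem sum_powerset_card_le_prod_le {ι : Type*} (P : Finset ι) (w : ι → ℝ) (hw : ∀ i ∈ P, 0 ≤ w i)
    {L : ℝ} (hL : 1 ≤ L) (hsum : ∑ i ∈ P, w i ≤ L) (k : ℕ) :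
    ∑ A ∈ P.powerset with A.card ≤ k, ∏ i ∈ A, w i ≤ Real.exp 1 * L ^ k := by
  have hL0 : 0 < L := by linarith
  have hnn : ∀ A ∈ P.powerset, 0 ≤ ∏ i ∈ A, w i / L := fun A hA ↦
    Finset.prod_nonneg fun i hi ↦ div_nonneg (hw i (Finset.mem_powerset.1 hA hi)) hL0.le
  calc _ ≤ ∑ A ∈ P.powerset with A.card ≤ k, L ^ k * ∏ i ∈ A, w i / L := by
        refine Finset.sum_le_sum fun A hA ↦ ?_
        obtain ⟨hA, hk⟩ := Finset.mem_filter.1 hA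
        calc ∏ i ∈ A, w i = L ^ A.card * ∏ i ∈ A, w i / L := by
              rw [← Finset.prod_const, ← Finset.prod_mul_distrib]
              exact Finset.prod_congr rfl fun i _ ↦ by field_simp
          _ ≤ _ := mul_le_mul_of_nonneg_right (pow_le_pow_right₀ hL hk) (hnn A hA)
    _ ≤ ∑ A ∈ P.powerset, L ^ k * ∏ i ∈ A, w i / L :=
        Finset.sum_le_sum_of_subset_of_nonneg (Finset.filter_subset _ _) fun A hA _ ↦
          mul_nonneg (by positivity) (hnn A hA)
    _ = L ^ k * ∏ i ∈ P, (1 + w i / L) := by rw [← Finset.mul_sum, Finset.prod_one_add]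
    _ ≤ L ^ k * Real.exp 1 := by
        gcongr
        calc ∏ i ∈ P, (1 + w i / L) ≤ Real.exp (∑ i ∈ P, w i / L) := by
                rw [Real.exp_sum]
                refine Finset.prod_le_prod
                  (fun i hi ↦ add_nonneg zero_le_one (div_nonneg (hw i hi) hL0.le)) fun i _ ↦ ?_
                rw [add_comm]
                exact Real.add_one_le_exp _
          _ ≤ Real.exp 1 := by
              rw [Real.exp_le_exp, ← Finset.sum_div, div_le_one hL0]
              exact hsum
    _ = _ := mul_comm _ _

theorem exists_sum_card_divisors_dvd_le {ℓ : ℕ} (hℓ : ℓ ≠ 0) :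
    ∃ K : ℝ, 0 < K ∧ ∀ y : ℝ, 4 ≤ y → ∀ S : Finset ℕ,
      (∀ s ∈ S, s ≠ 0 ∧ (∀ p, p.Prime → p ∣ s → (p : ℝ) ≤ y) ∧ s.divisors.card ∣ ℓ) →
      ∑ s ∈ S, (s : ℝ) ^ (1 / 4 / Real.log y - 1) ≤
        K * Real.log (Real.log y) ^ padicValNat 2 ℓ := by
  obtain ⟨K, hK0, hK⟩ := exists_sum_primes_le
  refine ⟨3 * (Real.exp 1 * K ^ padicValNat 2 ℓ), by positivity, fun y hy S hS ↦ ?_⟩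
  have hL1 := one_lt_log_of_four_le hy
  obtain ⟨hL, hsum⟩ := hK y hy
  set a := 1 / 4 / Real.log y - 1 with ha
  set k := padicValNat 2 ℓ
  set P := (⌊y⌋₊ + 1).primesBelow with hP
  have h2a : a * 2 ≤ -1 - 1 / 2 := by
    have : 1 / 4 / Real.log y ≤ 1 / 4 := div_le_self (by norm_num) hL1.le
    linarith
  have hex : ∀ s ∈ S, ∃ x : ℕ × Finset ℕ, x.1 ≠ 0 ∧ (x.2 ⊆ P ∧ x.2.card ≤ k) ∧
      s = x.1 ^ 2 * ∏ p ∈ x.2, p := fun s hs ↦ by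
    obtain ⟨hs0, hsy, hsd⟩ := hS s hs
    obtain ⟨c, b, rfl, hc⟩ := Nat.sq_mul_squarefree s
    have hb : b ≠ 0 := fun h ↦ hs0 (by simp [h])
    refine ⟨(b, c.primeFactors), hb, ⟨fun p hp ↦ ?_,
      card_primeFactors_le_of_card_divisors_dvd hb hc hℓ hsd⟩, ?_⟩
    · have hpp := Nat.prime_of_mem_primeFactors hp
      exact Nat.mem_primesBelow.2 ⟨Nat.lt_succ_of_le (Nat.le_floor
        (hsy p hpp ((Nat.dvd_of_mem_primeFactors hp).mul_left _))), hpp⟩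
    · rw [Nat.prod_primeFactors_of_squarefree hc]
  choose! φ hφ0 hφP hφs using hex
  have hinj : Set.InjOn φ S := fun s hs t ht h ↦ by rw [hφs s hs, hφs t ht, h]
  set B := S.image (fun s ↦ (φ s).1) with hB
  calc ∑ s ∈ S, (s : ℝ) ^ a
      ≤ ∑ s ∈ S, ((φ s).1 : ℝ) ^ (-1 - 1 / 2 : ℝ) * ∏ p ∈ (φ s).2, (p : ℝ) ^ a := by
        refine Finset.sum_le_sum fun s hs ↦ ?_
        have h1 : (1 : ℝ) ≤ (φ s).1 := by exact_mod_cast Nat.pos_of_ne_zero (hφ0 s hs)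
        conv_lhs => rw [hφs s hs]
        push_cast
        rw [Real.mul_rpow (by positivity) (Finset.prod_nonneg fun _ _ ↦ Nat.cast_nonneg _),
          ← Real.finsetProd_rpow _ _ (fun _ _ ↦ Nat.cast_nonneg _), ← Real.rpow_natCast,
          ← Real.rpow_mul (by positivity), mul_comm _ a]
        refine mul_le_mul_of_nonneg_right (Real.rpow_le_rpow_of_exponent_le h1 h2a)
          (Finset.prod_nonneg fun _ _ ↦ by positivity)
    _ = ∑ x ∈ S.image φ, (x.1 : ℝ) ^ (-1 - 1 / 2 : ℝ) * ∏ p ∈ x.2, (p : ℝ) ^ a :=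
        (Finset.sum_image (f := fun x : ℕ × Finset ℕ ↦
          (x.1 : ℝ) ^ (-1 - 1 / 2 : ℝ) * ∏ p ∈ x.2, (p : ℝ) ^ a) hinj).symm
    _ ≤ ∑ x ∈ B ×ˢ P.powerset.filter (fun A ↦ A.card ≤ k),
          (x.1 : ℝ) ^ (-1 - 1 / 2 : ℝ) * ∏ p ∈ x.2, (p : ℝ) ^ a := by
        refine Finset.sum_le_sum_of_subset_of_nonneg (fun x hx ↦ ?_) fun _ _ _ ↦
          mul_nonneg (by positivity) (Finset.prod_nonneg fun _ _ ↦ by positivity)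
        obtain ⟨s, hs, rfl⟩ := Finset.mem_image.1 hx
        exact Finset.mem_product.2 ⟨Finset.mem_image_of_mem _ hs, Finset.mem_filter.2
          ⟨Finset.mem_powerset.2 (hφP s hs).1, (hφP s hs).2⟩⟩
    _ = (∑ b ∈ B, (b : ℝ) ^ (-1 - 1 / 2 : ℝ)) *
          ∑ A ∈ P.powerset.filter (fun A ↦ A.card ≤ k), ∏ p ∈ A, (p : ℝ) ^ a := by
        rw [Finset.sum_mul_sum, Finset.sum_product]
    _ ≤ (1 + 1 / (1 / 2)) * (Real.exp 1 * (K * Real.log (Real.log y)) ^ k) := by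
        gcongr
        · refine sum_rpow_neg_one_sub_le (by norm_num) fun b hb ↦ ?_
          obtain ⟨s, hs, rfl⟩ := Finset.mem_image.1 hb
          exact hφ0 s hs
        · exact sum_powerset_card_le_prod_le P _ (fun _ _ ↦ by positivity) hL hsum k
    _ = _ := by rw [mul_pow]; norm_num; ring

theorem one_div_le_rpow_mul_exp {n : ℕ} {x y : ℝ} (hx : 0 < x) (hxn : x ≤ n) (hy : 1 < y) :
    1 / (n : ℝ) ≤
      (n : ℝ) ^ (1 / 4 / Real.log y - 1) * Real.exp (-(Real.log x) / (4 * Real.log y)) := by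
  have hn : (0 : ℝ) < n := hx.trans_le hxn
  have hL := Real.log_pos hy
  have h1 : 1 ≤ (n : ℝ) ^ (1 / 4 / Real.log y) * Real.exp (-(Real.log x) / (4 * Real.log y)) := by
    rw [Real.rpow_def_of_pos hn, ← Real.exp_add]
    refine Real.one_le_exp ?_
    have h2 : Real.log x ≤ Real.log n := Real.log_le_log hx hxn
    have h3 : Real.log n * (1 / 4 / Real.log y) + -(Real.log x) / (4 * Real.log y) =
        (Real.log n - Real.log x) / (4 * Real.log y) := by field_simp; ring
    rw [h3]
    exact div_nonneg (by linarith) (by positivity)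
  rw [Real.rpow_sub_one hn.ne', div_mul_eq_mul_div]
  gcongr

theorem stmt14 (ℓ : ℕ) (hℓ : 1 ≤ ℓ) :
    ∃ C : ℝ, 0 < C ∧
      ∀ x y : ℝ, 1 ≤ x → 4 ≤ y →
        (∑' n : ℕ,
            if 0 < n ∧ x ≤ (n : ℝ) ∧
                (∀ p : ℕ, p.Prime → p ∣ n → (p : ℝ) ≤ y) ∧
                ℓ + 1 ≤ n.divisors.card
            then Real.log ((dth n (ℓ + 1) : ℝ) / (dth n ℓ : ℝ)) / (n : ℝ) else 0)
          ≤ C * Real.log y * (Real.log (Real.log y)) ^ (padicValNat 2 ℓ + 1) *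
              Real.exp (-(Real.log x) / (4 * Real.log y)) := by
  obtain ⟨K₁, hK₁0, hK₁⟩ := exists_sum_primes_le
  obtain ⟨K₂, hK₂1, hK₂⟩ := exists_sum_rough_le
  obtain ⟨K₃, hK₃0, hK₃⟩ := exists_sum_card_divisors_dvd_le (ℓ := ℓ) (by omega)
  refine ⟨K₁ * K₂ * K₃, by positivity, fun x y hx hy ↦ ?_⟩
  have hL := one_lt_log_of_four_le hy
  have hLL := log_log_four_pos.trans_le (log_log_four_le hy)
  refine Real.tsum_le_of_sum_range_le (fun n ↦ ?_) fun N ↦ ?_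
  · split_ifs with h
    · obtain ⟨h1, -, h3, -⟩ := dth_consecutive hℓ h.2.2.2
      refine div_nonneg (Real.log_nonneg ?_) (Nat.cast_nonneg _)
      rw [one_le_div (by exact_mod_cast Nat.pos_of_mem_divisors h1)]
      exact_mod_cast h3.le
    · exact le_rfl
  rw [← Finset.sum_filter]
  set A := (Finset.range N).filter fun n : ℕ ↦ 0 < n ∧ x ≤ (n : ℝ) ∧
    (∀ p : ℕ, p.Prime → p ∣ n → (p : ℝ) ≤ y) ∧ ℓ + 1 ≤ n.divisors.card with hA
  set a := 1 / 4 / Real.log y - 1 with ha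
  set E := Real.exp (-(Real.log x) / (4 * Real.log y)) with hE
  set P := (⌊y⌋₊ + 1).primesBelow with hP
  set S := (Finset.range N).filter fun s : ℕ ↦ s ≠ 0 ∧
    (∀ p, p.Prime → p ∣ s → (p : ℝ) ≤ y) ∧ s.divisors.card ∣ ℓ with hS
  set M : ℕ → Finset ℕ := fun z ↦ (Finset.range N).filter fun m : ℕ ↦
    ∀ p, p.Prime → p ∣ m → z ≤ p ∧ (p : ℝ) ≤ y with hM
  set g : (Σ _ : ℕ, ℕ × ℕ) → ℝ := fun t ↦
    (Real.log t.1 * (t.1 : ℝ) ^ a) * ((t.2.1 : ℝ) ^ a * (t.2.2 : ℝ) ^ a) with hg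
  have hg0 : ∀ t, 0 ≤ g t := fun t ↦
    mul_nonneg (mul_nonneg (Real.log_natCast_nonneg _) (by positivity)) (by positivity)
  have hex : ∀ n ∈ A, ∃ t : Σ _ : ℕ, ℕ × ℕ, t ∈ P.sigma (fun z ↦ S ×ˢ M z) ∧
      n = t.2.1 * t.1 * t.2.2 ∧
      Real.log ((dth n (ℓ + 1) : ℝ) / (dth n ℓ : ℝ)) / (n : ℝ) ≤ g t * E := by
    intro n hn
    obtain ⟨hnN, hn0, hxn, hny, hcard⟩ := Finset.mem_filter.1 hn
    rw [Finset.mem_range] at hnN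
    obtain ⟨s, z, m, hz, rfl, hs, hm, hsd, hd0, hdz⟩ := exists_split_dth hℓ hcard
    have hzd : z ∣ s * z * m := (dvd_mul_left z s).mul_right m
    have hsdvd : s ∣ s * z * m := (dvd_mul_right s z).mul_right m
    have hmdvd : m ∣ s * z * m := dvd_mul_left m _
    refine ⟨⟨z, s, m⟩, ?_, rfl, ?_⟩
    · simp only [Finset.mem_sigma, Finset.mem_product, hP, hS, hM, Finset.mem_filter,
        Finset.mem_range, Nat.mem_primesBelow]
      exact ⟨⟨Nat.lt_succ_of_le (Nat.le_floor (hny z hz hzd)), hz⟩,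
        ⟨(Nat.le_of_dvd hn0 hsdvd).trans_lt hnN, (Nat.pos_of_dvd_of_pos hsdvd hn0).ne',
          fun p hp h ↦ hny p hp (h.trans hsdvd), hsd⟩,
        (Nat.le_of_dvd hn0 hmdvd).trans_lt hnN,
        fun p hp h ↦ ⟨hm p hp h, hny p hp (h.trans hmdvd)⟩⟩
    · have hd0' : (0 : ℝ) < dth (s * z * m) ℓ := by exact_mod_cast hd0
      have hd1 : dth (s * z * m) ℓ < dth (s * z * m) (ℓ + 1) := (dth_consecutive hℓ hcard).2.2.1
      have hlog : Real.log ((dth (s * z * m) (ℓ + 1) : ℝ) / (dth (s * z * m) ℓ : ℝ)) ≤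
          Real.log z := by
        refine Real.log_le_log (div_pos (by exact_mod_cast hd0.trans hd1) hd0') ?_
        rw [div_le_iff₀ hd0', mul_comm (z : ℝ)]
        exact_mod_cast hdz
      have hgt : g ⟨z, s, m⟩ = Real.log z * ((s * z * m : ℕ) : ℝ) ^ a := by
        simp only [hg]
        rw [Nat.cast_mul, Nat.cast_mul, Real.mul_rpow (by positivity) (by positivity),
          Real.mul_rpow (by positivity) (by positivity)]
        ring
      rw [hgt, div_eq_mul_one_div, mul_assoc (Real.log z)]
      exact mul_le_mul hlog (one_div_le_rpow_mul_exp (by linarith) hxn (by linarith))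
        (by positivity) (Real.log_natCast_nonneg z)
  choose! φ hφT hφn hφg using hex
  have hinj : Set.InjOn φ A := fun s hs t ht h ↦ by rw [hφn s hs, hφn t ht, h]
  calc _ ≤ ∑ n ∈ A, g (φ n) * E := Finset.sum_le_sum hφg
    _ = (∑ t ∈ A.image φ, g t) * E := by rw [← Finset.sum_mul, Finset.sum_image hinj]
    _ ≤ (∑ t ∈ P.sigma (fun z ↦ S ×ˢ M z), g t) * E := by
        refine mul_le_mul_of_nonneg_right (Finset.sum_le_sum_of_subset_of_nonneg
          (fun t ht ↦ ?_) fun t _ _ ↦ hg0 t) (Real.exp_pos _).le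
        obtain ⟨n, hn, rfl⟩ := Finset.mem_image.1 ht
        exact hφT n hn
    _ = (∑ z ∈ P, (z : ℝ) ^ a * ((∑ s ∈ S, (s : ℝ) ^ a) *
          (Real.log z * ∑ m ∈ M z, (m : ℝ) ^ a))) * E := by
        rw [Finset.sum_sigma]
        refine congrArg (· * E) (Finset.sum_congr rfl fun z _ ↦ ?_)
        simp only [hg]
        rw [← Finset.mul_sum, Finset.sum_product]
        simp only [← Finset.sum_mul_sum]
        ring
    _ ≤ (∑ z ∈ P, (z : ℝ) ^ a * ((K₃ * Real.log (Real.log y) ^ padicValNat 2 ℓ) *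
          (K₂ * Real.log y))) * E := by
        refine mul_le_mul_of_nonneg_right (Finset.sum_le_sum fun z hz ↦
          mul_le_mul_of_nonneg_left (mul_le_mul ?_ ?_ ?_ ?_) (by positivity)) (Real.exp_pos _).le
        · exact hK₃ y hy S fun s hs ↦ (Finset.mem_filter.1 hs).2
        · exact hK₂ y hy z (Nat.prime_of_mem_primesBelow hz).one_lt.le (primesBelow_floor_le hz)
            (M z) fun m hm ↦ (Finset.mem_filter.1 hm).2
        · exact mul_nonneg (Real.log_natCast_nonneg z)
            (Finset.sum_nonneg fun _ _ ↦ by positivity)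
        · positivity
    _ = (∑ z ∈ P, (z : ℝ) ^ a) * ((K₃ * Real.log (Real.log y) ^ padicValNat 2 ℓ) *
          (K₂ * Real.log y)) * E := by rw [← Finset.sum_mul]
    _ ≤ (K₁ * Real.log (Real.log y)) * ((K₃ * Real.log (Real.log y) ^ padicValNat 2 ℓ) *
          (K₂ * Real.log y)) * E := by
        gcongr
        exact (hK₁ y hy).2
    _ = _ := by rw [pow_succ]; ring
end
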